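/- Let A and B be connected ℕ-graded k-algebras finitely generated in degree 1 (i.e., A = ⊕_{n≥0} A_n with A_0 = k·1, dim_k A_1 < ∞, and A_{n+1} = A_1 · A_n for all n ≥ 0, and similarly for B), and let τ : B ⊗ A → A ⊗ B be a strongly graded twisting map. Endow S = A ⊗_τ B with the bigrading S_{(i,j)} := A_{i+j} ⊗ B_j and set S_i := ⊕_{j∈ℤ} S_{(i,j)}, so S_0 = A ∘_τ B. Then S is a densely bigraded algebra satisfying condition (D2); concretely: (a) for all i, j ∈ ℤ, the quotient k-vector space S_{i+j}/(S_i * S_j) is finite-dimensional, where S_i * S_j denotes the k-span of all twisted products ∇_τ(u ⊗ v) with u ∈ S_i, v ∈ S_j; (b) for every i ∈ ℤ there is a finite subset T ⊆ S_i such that S_i equals the k-span of {∇_τ(s ⊗ x) : s ∈ S_0, x ∈ T}, and likewise a finite subset T' ⊆ S_i such that S_i equals the k-span of {∇_τ(x ⊗ s) : s ∈ S_0, x ∈ T'}. -/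

import Mathlib

open TensorProduct

section TTPDefs

variable (k : Type*) [Field k]
variable {A B : Type*} [AddCommGroup A] [Module k A] [AddCommGroup B] [Module k B]

/-- The rearrangement `1 ⊗ τ ⊗ 1 : (A ⊗ B) ⊗ (A ⊗ B) → (A ⊗ A) ⊗ (B ⊗ B)`. -/
noncomputable def middleTwist (τ : B ⊗[k] A →ₗ[k] A ⊗[k] B) :
    (A ⊗[k] B) ⊗[k] (A ⊗[k] B) →ₗ[k] (A ⊗[k] A) ⊗[k] (B ⊗[k] B) :=
  (TensorProduct.assoc k A A (B ⊗[k] B)).symm.toLinearMap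
    ∘ₗ TensorProduct.map (LinearMap.id : A →ₗ[k] A) (TensorProduct.assoc k A B B).toLinearMap
    ∘ₗ TensorProduct.map (LinearMap.id : A →ₗ[k] A)
        (TensorProduct.map τ (LinearMap.id : B →ₗ[k] B))
    ∘ₗ TensorProduct.map (LinearMap.id : A →ₗ[k] A)
        (TensorProduct.assoc k B A B).symm.toLinearMap
    ∘ₗ (TensorProduct.assoc k A B (A ⊗[k] B)).toLinearMap

/-- The twisted tensor product multiplication `∇_τ = (mA ⊗ mB) ∘ (1 ⊗ τ ⊗ 1)` on `A ⊗ B`,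
for given multiplication maps `mA`, `mB`. -/
noncomputable def ttpMul (mA : A ⊗[k] A →ₗ[k] A) (mB : B ⊗[k] B →ₗ[k] B)
    (τ : B ⊗[k] A →ₗ[k] A ⊗[k] B) :
    (A ⊗[k] B) ⊗[k] (A ⊗[k] B) →ₗ[k] A ⊗[k] B :=
  TensorProduct.map mA mB ∘ₗ middleTwist k τ

/-- The rearrangement `1 ⊗ τ ⊗ 1 : (B ⊗ B) ⊗ (A ⊗ A) → (B ⊗ A) ⊗ (B ⊗ A)`. -/
noncomputable def preTwist (τ : B ⊗[k] A →ₗ[k] A ⊗[k] B) :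
    (B ⊗[k] B) ⊗[k] (A ⊗[k] A) →ₗ[k] (B ⊗[k] A) ⊗[k] (B ⊗[k] A) :=
  (TensorProduct.assoc k B A (B ⊗[k] A)).symm.toLinearMap
    ∘ₗ TensorProduct.map (LinearMap.id : B →ₗ[k] B) (TensorProduct.assoc k A B A).toLinearMap
    ∘ₗ TensorProduct.map (LinearMap.id : B →ₗ[k] B)
        (TensorProduct.map τ (LinearMap.id : A →ₗ[k] A))
    ∘ₗ TensorProduct.map (LinearMap.id : B →ₗ[k] B)
        (TensorProduct.assoc k B A A).symm.toLinearMap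
    ∘ₗ (TensorProduct.assoc k B B (A ⊗[k] A)).toLinearMap

/-- `τ : B ⊗ A → A ⊗ B` is a twisting map with respect to the given units `uA`, `uB` and
multiplication maps `mA`, `mB`: it is bijective, compatible with the units, and
`τ ∘ (mB ⊗ mA) = (mA ⊗ mB) ∘ (1 ⊗ τ ⊗ 1) ∘ (τ ⊗ τ) ∘ (1 ⊗ τ ⊗ 1)`. -/
def IsTwistingMapGen (uA : A) (mA : A ⊗[k] A →ₗ[k] A) (uB : B) (mB : B ⊗[k] B →ₗ[k] B)
    (τ : B ⊗[k] A →ₗ[k] A ⊗[k] B) : Prop :=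
  Function.Bijective τ ∧
  (∀ b : B, τ (b ⊗ₜ[k] uA) = uA ⊗ₜ[k] b) ∧
  (∀ a : A, τ (uB ⊗ₜ[k] a) = a ⊗ₜ[k] uB) ∧
  τ ∘ₗ TensorProduct.map mB mA
    = ttpMul k mA mB τ ∘ₗ TensorProduct.map τ τ ∘ₗ preTwist k τ

end TTPDefs

/-- A twisting map between two `k`-algebras `A` and `B`. -/
def IsTwistingMap (k : Type*) [Field k] {A B : Type*}
    [Ring A] [Algebra k A] [Ring B] [Algebra k B]
    (τ : B ⊗[k] A →ₗ[k] A ⊗[k] B) : Prop :=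
  IsTwistingMapGen k (1 : A) (LinearMap.mul' k A) (1 : B) (LinearMap.mul' k B) τ

/-- The image `p ⊗ q` of a pair of submodules inside `A ⊗ B`. -/
noncomputable def subTensor {k A B : Type*} [Field k] [AddCommGroup A] [Module k A]
    [AddCommGroup B] [Module k B] (p : Submodule k A) (q : Submodule k B) :
    Submodule k (A ⊗[k] B) :=
  LinearMap.range (TensorProduct.mapIncl p q)

/-- The piece `S_i = ⊕ⱼ S_{(i,j)} = ⊕ⱼ A_{i+j} ⊗ B_j` of the bigraded twisted tensor
product. -/
noncomputable def rowPiece {k A B : Type*} [Field k] [AddCommGroup A] [Module k A]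
    [AddCommGroup B] [Module k B]
    (𝒜 : ℤ → Submodule k A) (ℬ : ℤ → Submodule k B) (i : ℤ) :
    Submodule k (A ⊗[k] B) :=
  ⨆ j : ℤ, subTensor (𝒜 (i + j)) (ℬ j)

/-- The span of all twisted products of an element of `p` with an element of `q`. -/
noncomputable def mulSpan {k A B : Type*} [Field k]
    [Ring A] [Algebra k A] [Ring B] [Algebra k B]
    (τ : B ⊗[k] A →ₗ[k] A ⊗[k] B) (p q : Submodule k (A ⊗[k] B)) :
    Submodule k (A ⊗[k] B) :=
  Submodule.span k {z | ∃ u ∈ p, ∃ v ∈ q,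
    z = ttpMul k (LinearMap.mul' k A) (LinearMap.mul' k B) τ (u ⊗ₜ[k] v)}

/-!
Statement 14: For connected graded algebras `A`, `B` finitely generated in degree `1` and a
strongly graded twisting map `τ`, the bigraded twisted tensor product `S = A ⊗_τ B` (with
`S_{(i,j)} = A_{i+j} ⊗ B_j`, `S_i = ⊕ⱼ S_{(i,j)}`, `S_0 = A ∘_τ B`) is a densely bigraded
algebra satisfying condition (D2).
-/

section TwistedProducts

variable {k A B : Type*} [Field k] [Ring A] [Algebra k A] [Ring B] [Algebra k B]

/-- The twisted multiplication `∇_τ` as a bilinear map. -/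
noncomputable def ttpBilin (τ : B ⊗[k] A →ₗ[k] A ⊗[k] B) :
    A ⊗[k] B →ₗ[k] A ⊗[k] B →ₗ[k] A ⊗[k] B :=
  TensorProduct.curry (ttpMul k (LinearMap.mul' k A) (LinearMap.mul' k B) τ)

theorem ttpBilin_tmul_tmul (τ : B ⊗[k] A →ₗ[k] A ⊗[k] B) (a a' : A) (b b' : B) :
    ttpBilin τ (a ⊗ₜ b) (a' ⊗ₜ b')
      = TensorProduct.map (LinearMap.mulLeft k a) (LinearMap.mulRight k b') (τ (b ⊗ₜ a')) := by
  simp only [ttpBilin, ttpMul, middleTwist, TensorProduct.curry_apply, LinearMap.comp_apply,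
    LinearEquiv.coe_coe, TensorProduct.assoc_tmul, TensorProduct.map_tmul, LinearMap.id_apply,
    TensorProduct.assoc_symm_tmul]
  induction τ (b ⊗ₜ[k] a') with
  | zero => simp
  | tmul x y => simp
  | add x y hx hy => simp only [TensorProduct.add_tmul, TensorProduct.tmul_add, map_add, hx, hy]

theorem mulSpan_eq_map₂ (τ : B ⊗[k] A →ₗ[k] A ⊗[k] B) (p q : Submodule k (A ⊗[k] B)) :
    mulSpan τ p q = Submodule.map₂ (ttpBilin τ) p q := by
  rw [Submodule.map₂_eq_span_image2, mulSpan]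
  congr 1
  ext z
  simp only [Set.mem_ofPred_eq, Set.mem_image2, SetLike.mem_coe, eq_comm (a := z)]
  rfl

theorem span_mul_finset_eq_map₂ (τ : B ⊗[k] A →ₗ[k] A ⊗[k] B) (p : Submodule k (A ⊗[k] B))
    (T : Finset (A ⊗[k] B)) :
    Submodule.span k {z | ∃ s ∈ p, ∃ x ∈ T,
        z = ttpMul k (LinearMap.mul' k A) (LinearMap.mul' k B) τ (s ⊗ₜ[k] x)}
      = Submodule.map₂ (ttpBilin τ) p (Submodule.span k T) := by
  conv_rhs => rw [← Submodule.span_eq p, Submodule.map₂_span_span]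
  congr 1
  ext z
  simp only [Set.mem_ofPred_eq, Set.mem_image2, SetLike.mem_coe, eq_comm (a := z)]
  rfl

theorem span_finset_mul_eq_map₂ (τ : B ⊗[k] A →ₗ[k] A ⊗[k] B) (p : Submodule k (A ⊗[k] B))
    (T : Finset (A ⊗[k] B)) :
    Submodule.span k {z | ∃ s ∈ p, ∃ x ∈ T,
        z = ttpMul k (LinearMap.mul' k A) (LinearMap.mul' k B) τ (x ⊗ₜ[k] s)}
      = Submodule.map₂ (ttpBilin τ) (Submodule.span k T) p := by
  conv_rhs => rw [← Submodule.span_eq p, Submodule.map₂_span_span]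
  congr 1
  ext z
  simp only [Set.mem_ofPred_eq, Set.mem_image2, SetLike.mem_coe, eq_comm (a := z)]
  exact ⟨fun ⟨s, hs, x, hx, h⟩ => ⟨x, hx, s, hs, h⟩, fun ⟨x, hx, s, hs, h⟩ => ⟨s, hs, x, hx, h⟩⟩

end TwistedProducts

section SubTensor

variable {k A B : Type*} [Field k] [AddCommGroup A] [Module k A] [AddCommGroup B] [Module k B]

theorem subTensor_eq_map₂ (p : Submodule k A) (q : Submodule k B) :
    subTensor p q = Submodule.map₂ (TensorProduct.mk k A B) p q := by
  rw [subTensor, TensorProduct.range_mapIncl, Submodule.map₂_eq_span_image2]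

theorem tmul_mem_subTensor {p : Submodule k A} {q : Submodule k B} {a : A} {b : B}
    (ha : a ∈ p) (hb : b ∈ q) : a ⊗ₜ[k] b ∈ subTensor p q := by
  rw [subTensor_eq_map₂]
  exact Submodule.apply_mem_map₂ _ ha hb

theorem subTensor_le {p : Submodule k A} {q : Submodule k B} {r : Submodule k (A ⊗[k] B)} :
    subTensor p q ≤ r ↔ ∀ a ∈ p, ∀ b ∈ q, a ⊗ₜ[k] b ∈ r := by
  rw [subTensor_eq_map₂, Submodule.map₂_le]
  rfl

theorem subTensor_fg {p : Submodule k A} {q : Submodule k B} (hp : p.FG) (hq : q.FG) :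
    (subTensor p q).FG := by
  rw [subTensor_eq_map₂]
  exact hp.map₂ _ hq

theorem finrank_subTensor (p : Submodule k A) (q : Submodule k B) :
    Module.finrank k (subTensor p q) = Module.finrank k p * Module.finrank k q := by
  rw [subTensor, LinearMap.finrank_range_of_inj, Module.finrank_tensorProduct]
  exact TensorProduct.map_injective_of_flat_flat _ _ p.injective_subtype q.injective_subtype

/-- An injective map sending `q ⊗ p` into `p ⊗ q` is onto `p ⊗ q` when `p` and `q` are
finite dimensional. -/
theorem map_subTensor_eq {τ : B ⊗[k] A →ₗ[k] A ⊗[k] B} (hτ : Function.Injective τ)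
    {p : Submodule k A} {q : Submodule k B} (hp : p.FG) (hq : q.FG)
    (h : ∀ b ∈ q, ∀ a ∈ p, τ (b ⊗ₜ a) ∈ subTensor p q) :
    (subTensor q p).map τ = subTensor p q := by
  have : FiniteDimensional k (subTensor p q) :=
    Module.Finite.iff_fg.mpr (subTensor_fg hp hq)
  refine Submodule.eq_of_le_of_finrank_eq
    (Submodule.map_le_iff_le_comap.mpr (subTensor_le.mpr h)) ?_
  rw [← (Submodule.equivMapOfInjective τ hτ _).finrank_eq, finrank_subTensor, finrank_subTensor, mul_comm]

end SubTensor

section Graded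

variable {k A B : Type*} [Field k] [Ring A] [Algebra k A] [Ring B] [Algebra k B]

theorem map₂_ttpBilin_subTensor {τ : B ⊗[k] A →ₗ[k] A ⊗[k] B}
    {p p' : Submodule k A} {q q' : Submodule k B}
    (h : (subTensor q p').map τ = subTensor p' q) :
    Submodule.map₂ (ttpBilin τ) (subTensor p q) (subTensor p' q')
      = subTensor (p * p') (q * q') := by
  apply le_antisymm
  · rw [Submodule.map₂_le]
    intro u hu v hv
    have hu' : u ∈ Submodule.comap ((ttpBilin τ).flip v) (subTensor (p * p') (q * q')) := by
      refine subTensor_le.mpr (fun a ha b hb => ?_) hu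
      refine (subTensor_le (r := Submodule.comap (ttpBilin τ (a ⊗ₜ b))
        (subTensor (p * p') (q * q')))).mpr (fun a' ha' b' hb' => ?_) hv
      rw [Submodule.mem_comap, ttpBilin_tmul_tmul]
      have hmem : τ (b ⊗ₜ a') ∈ subTensor p' q :=
        h ▸ Submodule.mem_map_of_mem (tmul_mem_subTensor hb ha')
      refine (subTensor_le (r := Submodule.comap (TensorProduct.map (LinearMap.mulLeft k a)
        (LinearMap.mulRight k b')) (subTensor (p * p') (q * q')))).mpr
        (fun x hx y hy => ?_) hmem
      exact tmul_mem_subTensor (Submodule.mul_mem_mul ha hx) (Submodule.mul_mem_mul hy hb')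
    exact hu'
  · set R := Submodule.map₂ (ttpBilin τ) (subTensor p q) (subTensor p' q')
    have key : ∀ a ∈ p, ∀ a' ∈ p', ∀ b ∈ q, ∀ b' ∈ q', (a * a') ⊗ₜ[k] (b * b') ∈ R := by
      intro a ha a' ha' b hb b' hb'
      have hmem : a' ⊗ₜ[k] b ∈ (subTensor q p').map τ := h ▸ tmul_mem_subTensor ha' hb
      obtain ⟨y, hy, hya⟩ := hmem
      have hy' := (subTensor_le (r := Submodule.comap (TensorProduct.map (LinearMap.mulLeft k a)
        (LinearMap.mulRight k b') ∘ₗ τ) R)).mpr (fun x hx z hz => by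
          rw [Submodule.mem_comap, LinearMap.comp_apply, ← ttpBilin_tmul_tmul]
          exact Submodule.apply_mem_map₂ _ (tmul_mem_subTensor ha hx)
            (tmul_mem_subTensor hz hb')) hy
      simpa [hya] using hy'
    refine subTensor_le.mpr (fun a ha b hb => ?_)
    refine Submodule.mul_induction_on ha (fun x hx x' hx' => ?_) (fun x y hx hy => ?_)
    · refine Submodule.mul_induction_on hb (fun y hy y' hy' => key x hx x' hx' y hy y' hy')
        (fun y z hy hz => ?_)
      rw [TensorProduct.tmul_add]
      exact R.add_mem hy hz
    · rw [TensorProduct.add_tmul]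
      exact R.add_mem hx hy

theorem eq_pow_of_generated_in_degree_one {𝒜 : ℤ → Submodule k A}
    (h0 : 𝒜 0 = Submodule.span k {(1 : A)})
    (hgen : ∀ n : ℤ, 0 ≤ n → 𝒜 (n + 1)
      = Submodule.span k {x | ∃ a ∈ 𝒜 1, ∃ b ∈ 𝒜 n, x = a * b}) (n : ℕ) :
    𝒜 n = 𝒜 1 ^ n := by
  induction n with
  | zero => rw [pow_zero, Submodule.one_eq_span, Nat.cast_zero, h0]
  | succ n ih =>
    rw [pow_succ', ← ih, Nat.cast_succ, hgen n (Int.natCast_nonneg n),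
      Submodule.mul_eq_span_mul_set]
    congr 1
    ext x
    simp only [Set.mem_ofPred_eq, Set.mem_mul, SetLike.mem_coe, eq_comm (a := x)]

theorem mul_eq_of_generated_in_degree_one {𝒜 : ℤ → Submodule k A}
    (h : ∀ n : ℕ, 𝒜 n = 𝒜 1 ^ n) {i j : ℤ} (hi : 0 ≤ i) (hj : 0 ≤ j) :
    𝒜 i * 𝒜 j = 𝒜 (i + j) := by
  lift i to ℕ using hi
  lift j to ℕ using hj
  rw [h, h, ← pow_add, ← h, Nat.cast_add]

theorem fg_of_generated_in_degree_one {𝒜 : ℤ → Submodule k A}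
    (hneg : ∀ n : ℤ, n < 0 → 𝒜 n = ⊥) (h1 : (𝒜 1).FG)
    (h : ∀ n : ℕ, 𝒜 n = 𝒜 1 ^ n) (i : ℤ) : (𝒜 i).FG := by
  rcases lt_or_ge i 0 with hi | hi
  · rw [hneg i hi]
    exact Submodule.fg_bot
  · lift i to ℕ using hi
    rw [h]
    exact h1.pow i

variable {𝒜 : ℤ → Submodule k A} {ℬ : ℤ → Submodule k B}

theorem subTensor_eq_bot (hAneg : ∀ n : ℤ, n < 0 → 𝒜 n = ⊥) (hBneg : ∀ n : ℤ, n < 0 → ℬ n = ⊥)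
    {i j : ℤ} (h : i < 0 ∨ j < 0) : subTensor (𝒜 i) (ℬ j) = ⊥ := by
  rw [subTensor_eq_map₂]
  rcases h with h | h
  · rw [hAneg i h, Submodule.map₂_bot_left]
  · rw [hBneg j h, Submodule.map₂_bot_right]

theorem subTensor_le_rowPiece {i m n : ℤ} (h : m = i + n) :
    subTensor (𝒜 m) (ℬ n) ≤ rowPiece 𝒜 ℬ i := by
  subst h
  exact le_iSup (fun j => subTensor (𝒜 (i + j)) (ℬ j)) n

theorem exists_finset_span_subTensor_subset_rowPiece
    (hA : ∀ i, (𝒜 i).FG) (hB : ∀ i, (ℬ i).FG) {i m n : ℤ} (h : m = i + n) :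
    ∃ T : Finset (A ⊗[k] B), (T : Set (A ⊗[k] B)) ⊆ rowPiece 𝒜 ℬ i ∧
      Submodule.span k T = subTensor (𝒜 m) (ℬ n) := by
  obtain ⟨T, hT⟩ := subTensor_fg (hA m) (hB n)
  exact ⟨T, Submodule.span_le.mp (hT.le.trans (subTensor_le_rowPiece h)), hT⟩

theorem map₂_rowPiece_le {τ : B ⊗[k] A →ₗ[k] A ⊗[k] B}
    (hAneg : ∀ n : ℤ, n < 0 → 𝒜 n = ⊥) (hBneg : ∀ n : ℤ, n < 0 → ℬ n = ⊥)
    (hmul : ∀ m n m' n' : ℤ, 0 ≤ m → 0 ≤ n → 0 ≤ m' → 0 ≤ n' →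
      Submodule.map₂ (ttpBilin τ) (subTensor (𝒜 m) (ℬ n)) (subTensor (𝒜 m') (ℬ n'))
        = subTensor (𝒜 (m + m')) (ℬ (n + n')))
    (i j : ℤ) :
    Submodule.map₂ (ttpBilin τ) (rowPiece 𝒜 ℬ i) (rowPiece 𝒜 ℬ j) ≤ rowPiece 𝒜 ℬ (i + j) := by
  rw [rowPiece, rowPiece, Submodule.map₂_iSup_left]
  refine iSup_le fun m => ?_
  rw [Submodule.map₂_iSup_right]
  refine iSup_le fun n => ?_
  by_cases hm : i + m < 0 ∨ m < 0
  · simp [subTensor_eq_bot hAneg hBneg hm]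
  by_cases hn : j + n < 0 ∨ n < 0
  · simp [subTensor_eq_bot hAneg hBneg hn]
  rw [hmul _ _ _ _ (by omega) (by omega) (by omega) (by omega)]
  exact subTensor_le_rowPiece (by ring)

theorem rowPiece_le_map₂_rowPiece_zero_left {τ : B ⊗[k] A →ₗ[k] A ⊗[k] B}
    (hAneg : ∀ n : ℤ, n < 0 → 𝒜 n = ⊥) (hBneg : ∀ n : ℤ, n < 0 → ℬ n = ⊥)
    (hmul : ∀ m n m' n' : ℤ, 0 ≤ m → 0 ≤ n → 0 ≤ m' → 0 ≤ n' →
      Submodule.map₂ (ttpBilin τ) (subTensor (𝒜 m) (ℬ n)) (subTensor (𝒜 m') (ℬ n'))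
        = subTensor (𝒜 (m + m')) (ℬ (n + n')))
    (i : ℤ) :
    rowPiece 𝒜 ℬ i ≤ Submodule.map₂ (ttpBilin τ) (rowPiece 𝒜 ℬ 0)
      (subTensor (𝒜 (max i 0)) (ℬ (max (-i) 0))) := by
  refine iSup_le fun n => ?_
  by_cases hn : i + n < 0 ∨ n < 0
  · simp [subTensor_eq_bot hAneg hBneg hn]
  have h := hmul (n - max (-i) 0) (n - max (-i) 0) (max i 0) (max (-i) 0)
    (by omega) (by omega) (by omega) (by omega)
  rw [show n - max (-i) 0 + max i 0 = i + n by omega, sub_add_cancel] at h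
  rw [← h]
  exact Submodule.map₂_le_map₂_left (subTensor_le_rowPiece (by ring))

theorem rowPiece_le_map₂_rowPiece_zero_right {τ : B ⊗[k] A →ₗ[k] A ⊗[k] B}
    (hAneg : ∀ n : ℤ, n < 0 → 𝒜 n = ⊥) (hBneg : ∀ n : ℤ, n < 0 → ℬ n = ⊥)
    (hmul : ∀ m n m' n' : ℤ, 0 ≤ m → 0 ≤ n → 0 ≤ m' → 0 ≤ n' →
      Submodule.map₂ (ttpBilin τ) (subTensor (𝒜 m) (ℬ n)) (subTensor (𝒜 m') (ℬ n'))
        = subTensor (𝒜 (m + m')) (ℬ (n + n')))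
    (i : ℤ) :
    rowPiece 𝒜 ℬ i ≤ Submodule.map₂ (ttpBilin τ)
      (subTensor (𝒜 (max i 0)) (ℬ (max (-i) 0))) (rowPiece 𝒜 ℬ 0) := by
  refine iSup_le fun n => ?_
  by_cases hn : i + n < 0 ∨ n < 0
  · simp [subTensor_eq_bot hAneg hBneg hn]
  have h := hmul (max i 0) (max (-i) 0) (n - max (-i) 0) (n - max (-i) 0)
    (by omega) (by omega) (by omega) (by omega)
  rw [show max i 0 + (n - max (-i) 0) = i + n by omega, add_sub_cancel] at h
  rw [← h]
  exact Submodule.map₂_le_map₂_right (subTensor_le_rowPiece (by ring))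

theorem rowPiece_add_le_sup_map₂ {τ : B ⊗[k] A →ₗ[k] A ⊗[k] B}
    (hAneg : ∀ n : ℤ, n < 0 → 𝒜 n = ⊥) (hBneg : ∀ n : ℤ, n < 0 → ℬ n = ⊥)
    (hmul : ∀ m n m' n' : ℤ, 0 ≤ m → 0 ≤ n → 0 ≤ m' → 0 ≤ n' →
      Submodule.map₂ (ttpBilin τ) (subTensor (𝒜 m) (ℬ n)) (subTensor (𝒜 m') (ℬ n'))
        = subTensor (𝒜 (m + m')) (ℬ (n + n')))
    (i j : ℤ) :
    rowPiece 𝒜 ℬ (i + j) ≤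
      (⨆ n ∈ Finset.Ico 0 (max (-i) 0 + max (-j) 0), subTensor (𝒜 (i + j + n)) (ℬ n)) ⊔
        Submodule.map₂ (ttpBilin τ) (rowPiece 𝒜 ℬ i) (rowPiece 𝒜 ℬ j) := by
  refine iSup_le fun n => ?_
  by_cases hn : n < 0
  · simp [subTensor_eq_bot hAneg hBneg (Or.inr hn)]
  by_cases hn' : n < max (-i) 0 + max (-j) 0
  · exact le_sup_of_le_left (le_iSup₂_of_le n (Finset.mem_Ico.mpr ⟨by omega, hn'⟩) le_rfl)
  refine le_sup_of_le_right ?_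
  have h := hmul (i + max (-i) 0) (max (-i) 0) (j + (n - max (-i) 0)) (n - max (-i) 0)
    (by omega) (by omega) (by omega) (by omega)
  rw [show i + max (-i) 0 + (j + (n - max (-i) 0)) = i + j + n by ring, add_sub_cancel] at h
  rw [← h]
  exact Submodule.map₂_le_map₂ (subTensor_le_rowPiece rfl) (subTensor_le_rowPiece rfl)

end Graded

theorem finiteDimensional_quotient_comap_of_le_sup {k V : Type*} [Field k] [AddCommGroup V]
    [Module k V] {R F W : Submodule k V} (hF : F.FG) (h : R ≤ F ⊔ W) :
    FiniteDimensional k (R ⧸ Submodule.comap R.subtype W) := by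
  have hker : LinearMap.ker (W.mkQ ∘ₗ R.subtype) = Submodule.comap R.subtype W := by
    rw [LinearMap.ker_comp, Submodule.ker_mkQ]
  have hle : LinearMap.range (W.mkQ ∘ₗ R.subtype) ≤ F.map W.mkQ := by
    rw [LinearMap.range_comp, Submodule.range_subtype]
    refine (Submodule.map_mono h).trans ?_
    rw [Submodule.map_sup, Submodule.mkQ_map_self, sup_bot_eq]
  have : FiniteDimensional k (F.map W.mkQ) := Module.Finite.iff_fg.mpr (hF.map _)
  have : FiniteDimensional k (LinearMap.range (W.mkQ ∘ₗ R.subtype)) :=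
    Submodule.finiteDimensional_of_le hle
  rw [← hker]
  exact (LinearMap.quotKerEquivRange _).symm.finiteDimensional

theorem twisted_tensor_product_densely_bigraded
    {k A B : Type*} [Field k]
    [Ring A] [Algebra k A] [Ring B] [Algebra k B]
    (𝒜 : ℤ → Submodule k A) (ℬ : ℤ → Submodule k B)
    [DirectSum.Decomposition 𝒜] [DirectSum.Decomposition ℬ]
    (hAmul : ∀ (i j : ℤ) (a a' : A), a ∈ 𝒜 i → a' ∈ 𝒜 j → a * a' ∈ 𝒜 (i + j))
    (hBmul : ∀ (i j : ℤ) (b b' : B), b ∈ ℬ i → b' ∈ ℬ j → b * b' ∈ ℬ (i + j))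
    -- `A` and `B` are `ℕ`-graded (no negative components)
    (hAneg : ∀ n : ℤ, n < 0 → 𝒜 n = ⊥) (hBneg : ∀ n : ℤ, n < 0 → ℬ n = ⊥)
    -- `A` and `B` are connected: the degree-`0` part is `k·1`
    (hA0 : 𝒜 0 = Submodule.span k {(1 : A)}) (hB0 : ℬ 0 = Submodule.span k {(1 : B)})
    -- the degree-`1` parts are finite dimensional
    (hA1fin : FiniteDimensional k (𝒜 1)) (hB1fin : FiniteDimensional k (ℬ 1))
    -- `A` and `B` are generated in degree `1`
    (hAgen : ∀ n : ℤ, 0 ≤ n → 𝒜 (n + 1)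
      = Submodule.span k {x | ∃ a ∈ 𝒜 1, ∃ b ∈ 𝒜 n, x = a * b})
    (hBgen : ∀ n : ℤ, 0 ≤ n → ℬ (n + 1)
      = Submodule.span k {x | ∃ a ∈ ℬ 1, ∃ b ∈ ℬ n, x = a * b})
    (τ : B ⊗[k] A →ₗ[k] A ⊗[k] B) (hτ : IsTwistingMap k τ)
    -- `τ` is strongly graded
    (hsg : ∀ (i j : ℤ) (b : B) (a : A), b ∈ ℬ j → a ∈ 𝒜 i →
      τ (b ⊗ₜ[k] a) ∈ subTensor (𝒜 i) (ℬ j)) :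
    -- (a) `S` is densely (bi)graded: `S_{i+j}/(S_i * S_j)` is finite dimensional
    (∀ i j : ℤ, FiniteDimensional k
      (↥(rowPiece 𝒜 ℬ (i + j)) ⧸
        Submodule.comap (rowPiece 𝒜 ℬ (i + j)).subtype
          (mulSpan τ (rowPiece 𝒜 ℬ i) (rowPiece 𝒜 ℬ j)))) ∧
    -- (b) condition (D2): each `S_i` is finitely generated as a right and as a left
    -- module over `S_0`
    (∀ i : ℤ,
      (∃ T : Finset (A ⊗[k] B), (↑T : Set (A ⊗[k] B)) ⊆ rowPiece 𝒜 ℬ i ∧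
        rowPiece 𝒜 ℬ i = Submodule.span k {z | ∃ s ∈ rowPiece 𝒜 ℬ 0, ∃ x ∈ T,
          z = ttpMul k (LinearMap.mul' k A) (LinearMap.mul' k B) τ (s ⊗ₜ[k] x)}) ∧
      (∃ T : Finset (A ⊗[k] B), (↑T : Set (A ⊗[k] B)) ⊆ rowPiece 𝒜 ℬ i ∧
        rowPiece 𝒜 ℬ i = Submodule.span k {z | ∃ s ∈ rowPiece 𝒜 ℬ 0, ∃ x ∈ T,
          z = ttpMul k (LinearMap.mul' k A) (LinearMap.mul' k B) τ (x ⊗ₜ[k] s)})) := by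
  have hA := eq_pow_of_generated_in_degree_one hA0 hAgen
  have hB := eq_pow_of_generated_in_degree_one hB0 hBgen
  have hAfg := fg_of_generated_in_degree_one hAneg (Module.Finite.iff_fg.mp hA1fin) hA
  have hBfg := fg_of_generated_in_degree_one hBneg (Module.Finite.iff_fg.mp hB1fin) hB
  have hmul : ∀ m n m' n' : ℤ, 0 ≤ m → 0 ≤ n → 0 ≤ m' → 0 ≤ n' →
      Submodule.map₂ (ttpBilin τ) (subTensor (𝒜 m) (ℬ n)) (subTensor (𝒜 m') (ℬ n'))
        = subTensor (𝒜 (m + m')) (ℬ (n + n')) := by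
    intro m n m' n' hm hn hm' hn'
    rw [map₂_ttpBilin_subTensor (map_subTensor_eq hτ.1.1 (hAfg m') (hBfg n)
      fun b hb a ha => hsg m' n b a hb ha), mul_eq_of_generated_in_degree_one hA hm hm',
      mul_eq_of_generated_in_degree_one hB hn hn']
  refine ⟨fun i j => ?_, fun i => ?_⟩
  · rw [mulSpan_eq_map₂]
    exact finiteDimensional_quotient_comap_of_le_sup
      (Submodule.fg_biSup _ _ fun n _ => subTensor_fg (hAfg _) (hBfg n))
      (rowPiece_add_le_sup_map₂ hAneg hBneg hmul i j)
  · have hi : max i 0 = i + max (-i) 0 := by omega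
    obtain ⟨T, hTi, hT⟩ := exists_finset_span_subTensor_subset_rowPiece hAfg hBfg hi
    have hle : subTensor (𝒜 (max i 0)) (ℬ (max (-i) 0)) ≤ rowPiece 𝒜 ℬ i :=
      subTensor_le_rowPiece hi
    refine ⟨⟨T, hTi, ?_⟩, ⟨T, hTi, ?_⟩⟩
    · rw [span_mul_finset_eq_map₂, hT]
      refine le_antisymm (rowPiece_le_map₂_rowPiece_zero_left hAneg hBneg hmul i) ?_
      refine (Submodule.map₂_le_map₂_right hle).trans ?_
      simpa using map₂_rowPiece_le hAneg hBneg hmul 0 i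
    · rw [span_finset_mul_eq_map₂, hT]
      refine le_antisymm (rowPiece_le_map₂_rowPiece_zero_right hAneg hBneg hmul i) ?_
      refine (Submodule.map₂_le_map₂_left hle).trans ?_
      simpa using map₂_rowPiece_le hAneg hBneg hmul i 0
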